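/- Critical-case weighted fractional Orlicz–Hardy inequality with logarithmic correction on a ball: let N ≥ 1, s ∈ (0,1), α₁, α₂ ∈ ℝ, γ = s − α₁ − α₂, R > 0, and let Φ be an Orlicz function with p⁺ = sup_{t>0} tφ(t)/Φ(t). Suppose γ = N/p⁺. Then there exists C > 0 such that for every u ∈ C_c¹(ℝ^N) with supp(u) ⊂ B_R(0): ∫_{B_R(0)} Φ(|x|^{−γ}|u(x)|) / (log(2R/|x|))^{p⁺} dx ≤ C ∫_{ℝ^N}∫_{ℝ^N} Φ(|x|^{α₁}|y|^{α₂}|u(x)−u(y)|/|x−y|^s) dx dy/|x−y|^N. -/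

import Mathlib

open Set Filter MeasureTheory

/-- An Orlicz function `Φ` together with its right derivative `φ`:
`Φ` is continuous, convex on `[0,∞)`, vanishes at `0`, satisfies
`Φ(t)/t → 0` as `t → 0⁺`, `Φ(t)/t → ∞` as `t → ∞`, the Δ₂-condition,
and has the representation `Φ(t) = ∫₀ᵗ φ(s) ds` with `φ` non-decreasing,
right-continuous, `φ(0) = 0`, `φ(t) > 0` for `t > 0`, `φ(t) → ∞`. -/
structure IsOrliczPair (Φ φ : ℝ → ℝ) : Prop where
  continuousOn : ContinuousOn Φ (Ici 0)
  convexOn : ConvexOn ℝ (Ici 0) Φ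
  map_zero : Φ 0 = 0
  tendsto_zero : Tendsto (fun t => Φ t / t) (nhdsWithin 0 (Ioi 0)) (nhds 0)
  tendsto_atTop : Tendsto (fun t => Φ t / t) atTop atTop
  delta2 : ∃ C > 0, ∀ t ≥ 0, Φ (2 * t) ≤ C * Φ t
  rep : ∀ t ≥ 0, Φ t = ∫ s in (0:ℝ)..t, φ s
  deriv_mono : MonotoneOn φ (Ici 0)
  deriv_rightCont : ∀ t ≥ 0, ContinuousWithinAt φ (Ici t) t
  deriv_zero : φ 0 = 0
  deriv_pos : ∀ t > 0, 0 < φ t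
  deriv_atTop : Tendsto φ atTop atTop

/-- The set of values `t·φ(t)/Φ(t)` for `t > 0`, whose infimum and supremum
are `p⁻_Φ` and `p⁺_Φ`. -/
def orliczRatioSet (Φ φ : ℝ → ℝ) : Set ℝ := {r : ℝ | ∃ t > 0, r = t * φ t / Φ t}

namespace IsOrliczPair

variable {Φ φ : ℝ → ℝ}

lemma intervalIntegrable (h : IsOrliczPair Φ φ) {a b : ℝ} (ha : 0 ≤ a) (hb : 0 ≤ b) :
    IntervalIntegrable φ volume a b :=
  (h.deriv_mono.mono fun _ hx => (le_min ha hb).trans hx.1).intervalIntegrable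

lemma pos (h : IsOrliczPair Φ φ) {t : ℝ} (ht : 0 < t) : 0 < Φ t := by
  rw [h.rep t ht.le]
  exact intervalIntegral.intervalIntegral_pos_of_pos_on (h.intervalIntegrable le_rfl ht.le)
    (fun x hx => h.deriv_pos x hx.1) ht

lemma nonneg (h : IsOrliczPair Φ φ) {t : ℝ} (ht : 0 ≤ t) : 0 ≤ Φ t := by
  rcases ht.eq_or_lt with rfl | ht
  · exact h.map_zero.ge
  · exact (h.pos ht).le

lemma hasDerivWithinAt (h : IsOrliczPair Φ φ) {t : ℝ} (ht : 0 < t) :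
    HasDerivWithinAt Φ (φ t) (Ici t) t := by
  have hmeas : StronglyMeasurableAtFilter φ (nhdsWithin t (Ioi t)) volume :=
    ⟨Ioc t (t + 1), Ioc_mem_nhdsGT (by linarith),
      (h.intervalIntegrable ht.le (by linarith : (0 : ℝ) ≤ t + 1)).1.aestronglyMeasurable⟩
  have key := intervalIntegral.integral_hasDerivWithinAt_right
    (h.intervalIntegrable le_rfl ht.le) (s := Ici t) hmeas
    ((h.deriv_rightCont t ht.le).mono Ioi_subset_Ici_self)
  exact key.congr (fun x hx => h.rep x (ht.le.trans hx)) (h.rep t ht.le)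

lemma map_le_map (h : IsOrliczPair Φ φ) {a b : ℝ} (ha : 0 ≤ a) (hab : a ≤ b) : Φ a ≤ Φ b := by
  have hb := ha.trans hab
  rw [h.rep b hb, h.rep a ha, ← sub_nonneg, intervalIntegral.integral_interval_sub_left
    (h.intervalIntegrable le_rfl hb) (h.intervalIntegrable le_rfl ha)]
  refine intervalIntegral.integral_nonneg hab fun x hx => ?_
  rcases (ha.trans hx.1).eq_or_lt with rfl | hx0
  · exact h.deriv_zero.ge
  · exact (h.deriv_pos x hx0).le

/-- If `tφ(t) ≤ p Φ(t)`, then `Φ` grows at most like the power `p`. -/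
lemma map_mul_le (h : IsOrliczPair Φ φ) {p : ℝ} (hp : p ∈ upperBounds (orliczRatioSet Φ φ))
    {c t : ℝ} (hc : 1 ≤ c) (ht : 0 ≤ t) : Φ (c * t) ≤ c ^ p * Φ t := by
  rcases ht.eq_or_lt with rfl | ht
  · simp [h.map_zero]
  have hle : t ≤ c * t := le_mul_of_one_le_left ht.le hc
  have hpos : ∀ x ∈ Icc t (c * t), 0 < x := fun x hx => ht.trans_le hx.1
  have hd : ∀ x ∈ Ico t (c * t), HasDerivWithinAt (fun x => Φ x * x ^ (-p))
      (φ x * x ^ (-p) + Φ x * (-p * x ^ (-p - 1))) (Ici x) x := fun x hx =>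
    (h.hasDerivWithinAt (hpos x (Ico_subset_Icc_self hx))).mul
      (Real.hasDerivAt_rpow_const (Or.inl (hpos x (Ico_subset_Icc_self hx)).ne')).hasDerivWithinAt
  have hcont : ContinuousOn (fun x => Φ x * x ^ (-p)) (Icc t (c * t)) :=
    (h.continuousOn.mono fun x hx => (hpos x hx).le).mul fun x hx =>
      (Real.continuousAt_rpow_const x _ (Or.inl (hpos x hx).ne')).continuousWithinAt
  have key := image_le_of_deriv_right_le_deriv_boundary hcont hd
    (B := fun _ => Φ t * t ^ (-p)) (B' := fun _ => 0) le_rfl continuousOn_const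
    (fun x _ => hasDerivWithinAt_const x _ _) (fun x hx => by
      have hx0 := hpos x (Ico_subset_Icc_self hx)
      have h1 : x * φ x / Φ x ≤ p := hp ⟨x, hx0, rfl⟩
      rw [div_le_iff₀ (h.pos hx0)] at h1
      have h2 : x ^ (-p) = x ^ (-p - 1) * x := by
        rw [← Real.rpow_add_one hx0.ne']; ring_nf
      rw [h2]
      have h3 : 0 < x ^ (-p - 1) := Real.rpow_pos_of_pos hx0 _
      nlinarith) (right_mem_Icc.2 hle)
  have hc0 : 0 < c := by linarith
  rw [Real.mul_rpow hc0.le ht.le, Real.rpow_neg hc0.le] at key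
  have h4 : 0 < t ^ (-p) := Real.rpow_pos_of_pos ht _
  have h5 : 0 < c ^ p := Real.rpow_pos_of_pos hc0 _
  have h6 : (c ^ p)⁻¹ * Φ (c * t) ≤ Φ t := by
    refine le_of_mul_le_mul_right ?_ h4
    linarith
  rwa [inv_mul_le_iff₀ h5] at h6

lemma one_lt_of_mem_upperBounds (h : IsOrliczPair Φ φ) {p : ℝ}
    (hp : p ∈ upperBounds (orliczRatioSet Φ φ)) : 1 < p := by
  by_contra! hp1
  have hev : ∀ᶠ t in nhdsWithin (0 : ℝ) (Ioi 0), Φ 1 ≤ Φ t / t := by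
    filter_upwards [Ioc_mem_nhdsGT (zero_lt_one' ℝ)] with t ht
    have h1 := h.map_mul_le hp (one_le_inv₀ ht.1 |>.2 ht.2) ht.1.le
    rw [inv_mul_cancel₀ ht.1.ne'] at h1
    have h2 : t⁻¹ ^ p ≤ t⁻¹ :=
      (Real.rpow_le_rpow_of_exponent_le (one_le_inv₀ ht.1 |>.2 ht.2) hp1).trans_eq
        (Real.rpow_one _)
    calc Φ 1 ≤ t⁻¹ ^ p * Φ t := h1
      _ ≤ t⁻¹ * Φ t := mul_le_mul_of_nonneg_right h2 (h.nonneg ht.1.le)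
      _ = Φ t / t := by rw [div_eq_inv_mul]
  exact absurd (ge_of_tendsto h.tendsto_zero hev) (not_le.2 (h.pos one_pos))

/-- Splitting inequality, obtained from convexity with weights `q / (q + r)` and `r / (q + r)`. -/
lemma map_add_mul_le (h : IsOrliczPair Φ φ) {p : ℝ} (hp : p ∈ upperBounds (orliczRatioSet Φ φ))
    {a b q r : ℝ} (ha : 0 ≤ a) (hb : 0 ≤ b) (hq : 0 < q) (hr : 0 < r) :
    Φ (a + b) * (q + r) ^ (1 - p) ≤ Φ a * q ^ (1 - p) + Φ b * r ^ (1 - p) := by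
  have hqr : 0 < q + r := by positivity
  have hconv := h.convexOn.2 (mem_Ici.2 (by positivity : 0 ≤ (q + r) / q * a))
    (mem_Ici.2 (by positivity : 0 ≤ (q + r) / r * b))
    (by positivity : 0 ≤ q / (q + r)) (by positivity : 0 ≤ r / (q + r)) (by field_simp)
  have e : (q / (q + r)) • ((q + r) / q * a) + (r / (q + r)) • ((q + r) / r * b) = a + b := by
    simp only [smul_eq_mul]; field_simp
  rw [e] at hconv
  have main : ∀ {c z : ℝ}, 0 < z → z ≤ q + r → 0 ≤ c →
      z / (q + r) * Φ ((q + r) / z * c) * (q + r) ^ (1 - p) ≤ Φ c * z ^ (1 - p) := by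
    intro c z hz hzq hc
    have h1 := h.map_mul_le hp (one_le_div hz |>.2 hzq) hc
    have h2 : z / (q + r) * ((q + r) / z) ^ p * (q + r) ^ (1 - p) = z ^ (1 - p) := by
      rw [Real.div_rpow hqr.le hz.le, Real.rpow_sub hqr, Real.rpow_sub hz, Real.rpow_one,
        Real.rpow_one]
      have := Real.rpow_pos_of_pos hqr p
      have := Real.rpow_pos_of_pos hz p
      field_simp
    calc z / (q + r) * Φ ((q + r) / z * c) * (q + r) ^ (1 - p)
        ≤ z / (q + r) * (((q + r) / z) ^ p * Φ c) * (q + r) ^ (1 - p) := by gcongr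
      _ = Φ c * z ^ (1 - p) := by rw [← h2]; ring
  calc Φ (a + b) * (q + r) ^ (1 - p)
      ≤ (q / (q + r) * Φ ((q + r) / q * a) + r / (q + r) * Φ ((q + r) / r * b))
        * (q + r) ^ (1 - p) := by
        gcongr; simpa only [smul_eq_mul] using hconv
    _ ≤ _ := by
        rw [add_mul]
        exact add_le_add (main hq (by linarith) ha) (main hr (by linarith) hb)

end IsOrliczPair

/-- Comparison of `n ^ (-p)` with the increments of `n ^ (1 - p)`. -/
lemma rpow_add_half_add_le {p n : ℝ} (hp : 1 < p) (hn : 1 ≤ n) :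
    (n + 1 / 2) ^ (1 - p) + (p - 1) / (p + 2) * n ^ (-p) ≤ n ^ (1 - p) := by
  have hn0 : 0 < n := by linarith
  have hx : 0 < 1 + 1 / (2 * n) := by positivity
  have e : n + 1 / 2 = n * (1 + 1 / (2 * n)) := by field_simp
  have hb := one_add_mul_self_le_rpow_one_add (s := 1 / (2 * n))
    (by have : 0 < 1 / (2 * n) := by positivity
        linarith) hp.le
  have hA := Real.rpow_pos_of_pos hx p
  have h1 : (1 + 1 / (2 * n)) ^ (1 - p) ≤ (1 + 1 / (2 * n)) / (1 + p * (1 / (2 * n))) := by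
    rw [Real.rpow_sub hx, Real.rpow_one]
    gcongr
  have h2 : n ^ (-p) = n ^ (1 - p) * n⁻¹ := by
    rw [← div_eq_mul_inv, ← Real.rpow_sub_one hn0.ne']; ring_nf
  have h3 : (1 + 1 / (2 * n)) / (1 + p * (1 / (2 * n))) + (p - 1) / (p + 2) * n⁻¹ ≤ 1 := by
    have : (1 + 1 / (2 * n)) / (1 + p * (1 / (2 * n))) = (2 * n + 1) / (2 * n + p) := by
      field_simp
    rw [this, ← div_eq_mul_inv, div_div, div_add_div _ _ (by positivity) (by positivity),
      div_le_one (by positivity)]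
    nlinarith [mul_nonneg (mul_nonneg (sub_nonneg.2 hp.le) (by linarith : (0 : ℝ) ≤ p))
      (sub_nonneg.2 hn)]
  have hB := Real.rpow_pos_of_pos hn0 (1 - p)
  rw [e, Real.mul_rpow hn0.le hx.le, h2]
  calc _ ≤ n ^ (1 - p) * ((1 + 1 / (2 * n)) / (1 + p * (1 / (2 * n)))) +
        (p - 1) / (p + 2) * (n ^ (1 - p) * n⁻¹) := by gcongr
    _ = n ^ (1 - p) * ((1 + 1 / (2 * n)) / (1 + p * (1 / (2 * n))) + (p - 1) / (p + 2) * n⁻¹) := by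
        ring
    _ ≤ n ^ (1 - p) := mul_le_of_le_one_right hB.le h3

section Annulus

variable {E : Type*} [NormedAddCommGroup E]

/-- The half-open annulus `{x | r < ‖x‖ ≤ 2r}`. -/
def annulus (E : Type*) [NormedAddCommGroup E] (r : ℝ) : Set E := {x | r < ‖x‖ ∧ ‖x‖ ≤ 2 * r}

lemma measurableSet_annulus [MeasurableSpace E] [BorelSpace E] (r : ℝ) :
    MeasurableSet (annulus E r) :=
  (measurableSet_lt measurable_const measurable_norm).inter
    (measurableSet_le measurable_norm measurable_const)

lemma pairwise_disjoint_annulus {R : ℝ} (hR : 0 < R) :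
    Pairwise (Function.onFun Disjoint fun n : ℕ => annulus E (R * (1 / 2) ^ (n + 1))) := by
  have key : ∀ m n : ℕ, m < n → Disjoint (annulus E (R * (1 / 2) ^ (m + 1)))
      (annulus E (R * (1 / 2) ^ (n + 1))) := by
    intro m n hmn
    refine Set.disjoint_left.2 fun x hx hy => absurd hx.1 (not_lt.2 (hy.2.trans ?_))
    have : ((1 : ℝ) / 2) ^ (n + 1) ≤ (1 / 2) ^ (m + 1 + 1) :=
      pow_le_pow_of_le_one (by norm_num) (by norm_num) (by omega)
    rw [pow_succ _ (m + 1)] at this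
    nlinarith
  intro m n hmn
  rcases hmn.lt_or_gt with h | h
  · exact key m n h
  · exact (key n m h).symm

lemma ball_diff_zero_subset_iUnion_annulus {R : ℝ} (hR : 0 < R) :
    Metric.ball (0 : E) R \ {0} ⊆ ⋃ n : ℕ, annulus E (R * (1 / 2) ^ (n + 1)) := by
  rintro x ⟨hx, hx0⟩
  have hx0 : 0 < ‖x‖ := norm_pos_iff.2 hx0
  rw [mem_ball_zero_iff] at hx
  obtain ⟨n, h1, h2⟩ := exists_nat_pow_near_of_lt_one (div_pos hx0 hR)
    ((div_le_one hR).2 hx.le) (by norm_num : (0 : ℝ) < 1 / 2) (by norm_num)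
  rw [lt_div_iff₀ hR] at h1
  rw [div_le_iff₀ hR] at h2
  refine mem_iUnion.2 ⟨n, by linarith, ?_⟩
  rw [pow_succ]
  linarith

variable [NormedSpace ℝ E] [MeasurableSpace E] [FiniteDimensional ℝ E]
  (μ : Measure E) [μ.IsAddHaarMeasure]

lemma measure_annulus_ne_top {r : ℝ} : μ (annulus E r) ≠ ⊤ :=
  ((measure_mono fun _ hx => mem_closedBall_zero_iff.2 hx.2).trans_lt
    (measure_closedBall_lt_top (x := (0 : E)) (r := 2 * r))).ne

variable [BorelSpace E]

lemma measure_annulus {r : ℝ} (hr : 0 ≤ r) :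
    μ (annulus E r) = ENNReal.ofReal (r ^ Module.finrank ℝ E) *
      (ENNReal.ofReal (2 ^ Module.finrank ℝ E - 1) * μ (Metric.ball 0 1)) := by
  have e : annulus E r = Metric.closedBall 0 (2 * r) \ Metric.closedBall 0 r := by
    ext x; simp [annulus, and_comm]
  rw [e, measure_sdiff (Metric.closedBall_subset_closedBall (by linarith))
    measurableSet_closedBall.nullMeasurableSet measure_closedBall_lt_top.ne,
    Measure.addHaar_closedBall μ _ (by positivity), Measure.addHaar_closedBall μ _ hr,
    ← ENNReal.sub_mul (fun _ _ => measure_ball_lt_top.ne), ← mul_assoc,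
    ← ENNReal.ofReal_sub _ (by positivity), ← ENNReal.ofReal_mul (by positivity)]
  congr 3
  ring

lemma measure_annulus_pos [Nontrivial E] {r : ℝ} (hr : 0 < r) : μ (annulus E r) ≠ 0 := by
  have hd : Module.finrank ℝ E ≠ 0 := Module.finrank_pos.ne'
  have h2 : (1 : ℝ) < 2 ^ Module.finrank ℝ E := one_lt_pow₀ (by norm_num) hd
  rw [measure_annulus μ hr.le]
  refine mul_ne_zero ?_ (mul_ne_zero ?_ (Metric.measure_ball_pos μ _ one_pos).ne')
  · simpa using pow_pos hr _
  · simpa using h2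

lemma measure_annulus_two_mul {r : ℝ} (hr : 0 ≤ r) :
    μ (annulus E (2 * r)) = ENNReal.ofReal (2 ^ Module.finrank ℝ E) * μ (annulus E r) := by
  rw [measure_annulus μ (by positivity), measure_annulus μ hr, mul_pow,
    ENNReal.ofReal_mul (by positivity), mul_assoc]

end Annulus

namespace IsOrliczPair

variable {Φ φ : ℝ → ℝ}

lemma measurable_ofReal_comp {X : Type*} [TopologicalSpace X] [MeasurableSpace X]
    [OpensMeasurableSpace X] (h : IsOrliczPair Φ φ) {f : X → ℝ} (hf : Continuous f) (h0 : ∀ x, 0 ≤ f x) : Measurable fun x => ENNReal.ofReal (Φ (f x)) :=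
  (ENNReal.continuous_ofReal.comp (h.continuousOn.comp_continuous hf h0)).measurable

variable {E : Type*} [NormedAddCommGroup E] [NormedSpace ℝ E] [MeasurableSpace E]
  [BorelSpace E] [FiniteDimensional ℝ E]

/-- Comparison of the modulars of `u` over two consecutive annuli, at the critical scaling. -/
lemma setLIntegral_annulus_le (h : IsOrliczPair Φ φ) [Nontrivial E]
    (μ : Measure E) [μ.IsAddHaarMeasure] {p γ : ℝ}
    (hp : p ∈ upperBounds (orliczRatioSet Φ φ)) (hγ : 0 ≤ γ) (hγp : γ * p = Module.finrank ℝ E)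
    {u : E → ℝ} (hu : Continuous u) {r q t : ℝ} (hr : 0 < r) (hq : 0 < q) (ht : 0 < t) :
    (∫⁻ x in annulus E r, ENNReal.ofReal (Φ (|u x| / r ^ γ)) ∂μ) *
        ENNReal.ofReal ((q + t) ^ (1 - p)) ≤
      (∫⁻ x in annulus E (2 * r), ENNReal.ofReal (Φ (|u x| / (2 * r) ^ γ)) ∂μ) *
        ENNReal.ofReal (q ^ (1 - p)) +
      ENNReal.ofReal (t ^ (1 - p)) * ((μ (annulus E (2 * r)))⁻¹ *
        ∫⁻ x in annulus E r, ∫⁻ y in annulus E (2 * r),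
          ENNReal.ofReal (Φ (|u x - u y| / r ^ γ)) ∂μ ∂μ) := by
  set d := Module.finrank ℝ E
  have hrγ : 0 < r ^ γ := Real.rpow_pos_of_pos hr _
  have pointwise : ∀ x y, ENNReal.ofReal (Φ (|u x| / r ^ γ)) * ENNReal.ofReal ((q + t) ^ (1 - p)) ≤
      ENNReal.ofReal (2 ^ d) * ENNReal.ofReal (q ^ (1 - p)) *
        ENNReal.ofReal (Φ (|u y| / (2 * r) ^ γ)) +
      ENNReal.ofReal (t ^ (1 - p)) * ENNReal.ofReal (Φ (|u x - u y| / r ^ γ)) := by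
    intro x y
    have hy : 0 ≤ |u y| / r ^ γ := by positivity
    have hxy : 0 ≤ |u x - u y| / r ^ γ := by positivity
    have hy2 : 0 ≤ |u y| / (2 * r) ^ γ := by positivity
    have h1 : Φ (|u x| / r ^ γ) ≤ Φ (|u y| / r ^ γ + |u x - u y| / r ^ γ) := by
      refine h.map_le_map (by positivity) ?_
      rw [← add_div]
      gcongr
      have := abs_add_le (u y) (u x - u y)
      rwa [add_sub_cancel] at this
    have h2 : Φ (|u y| / r ^ γ) ≤ 2 ^ d * Φ (|u y| / (2 * r) ^ γ) := by
      have h3 := h.map_mul_le hp (Real.one_le_rpow one_le_two hγ) hy2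
      rw [← Real.rpow_mul zero_le_two, hγp, Real.rpow_natCast] at h3
      refine le_trans (le_of_eq ?_) h3
      rw [Real.mul_rpow zero_le_two hr.le]
      have : (0 : ℝ) < 2 ^ γ := Real.rpow_pos_of_pos two_pos _
      field_simp
    have h4 := h.map_add_mul_le hp hy hxy hq ht
    have hA : 0 < (q + t) ^ (1 - p) := Real.rpow_pos_of_pos (by positivity) _
    have hB : 0 < q ^ (1 - p) := Real.rpow_pos_of_pos hq _
    have hC : 0 < t ^ (1 - p) := Real.rpow_pos_of_pos ht _
    rw [← ENNReal.ofReal_mul' hA.le, ← ENNReal.ofReal_mul (by positivity),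
      ← ENNReal.ofReal_mul (by positivity), ← ENNReal.ofReal_mul hC.le,
      ← ENNReal.ofReal_add (mul_nonneg (by positivity) (h.nonneg hy2))
        (mul_nonneg hC.le (h.nonneg hxy))]
    refine ENNReal.ofReal_le_ofReal ?_
    calc Φ (|u x| / r ^ γ) * (q + t) ^ (1 - p)
        ≤ Φ (|u y| / r ^ γ + |u x - u y| / r ^ γ) * (q + t) ^ (1 - p) := by gcongr
      _ ≤ _ := h4
      _ ≤ 2 ^ d * Φ (|u y| / (2 * r) ^ γ) * q ^ (1 - p) +
          Φ (|u x - u y| / r ^ γ) * t ^ (1 - p) := by gcongr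
      _ = _ := by ring
  set m := μ (annulus E r)
  set M := μ (annulus E (2 * r))
  have hmM : M = ENNReal.ofReal (2 ^ d) * m := measure_annulus_two_mul μ hr.le
  have hM0 : M ≠ 0 := measure_annulus_pos μ (by positivity)
  have hMt : M ≠ ⊤ := measure_annulus_ne_top μ
  set F := ∫⁻ x in annulus E r, ENNReal.ofReal (Φ (|u x| / r ^ γ)) ∂μ
  set F' := ∫⁻ x in annulus E (2 * r), ENNReal.ofReal (Φ (|u x| / (2 * r) ^ γ)) ∂μ
  set D := ∫⁻ x in annulus E r, ∫⁻ y in annulus E (2 * r),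
          ENNReal.ofReal (Φ (|u x - u y| / r ^ γ)) ∂μ ∂μ
  set W := ENNReal.ofReal ((q + t) ^ (1 - p))
  set Q := ENNReal.ofReal (q ^ (1 - p))
  set T := ENNReal.ofReal (t ^ (1 - p))
  set K := ENNReal.ofReal (2 ^ d)
  have hmeas : Measurable fun y => ENNReal.ofReal (Φ (|u y| / (2 * r) ^ γ)) :=
    h.measurable_ofReal_comp (by fun_prop) fun _ => by positivity
  have inner : ∀ x, ENNReal.ofReal (Φ (|u x| / r ^ γ)) * (W * M) ≤
      K * Q * F' +
        T * ∫⁻ y in annulus E (2 * r), ENNReal.ofReal (Φ (|u x - u y| / r ^ γ)) ∂μ := by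
    intro x
    have h1 := lintegral_mono (μ := μ.restrict (annulus E (2 * r))) (pointwise x)
    rw [lintegral_const, Measure.restrict_apply_univ, lintegral_add_left (hmeas.const_mul _),
      lintegral_const_mul' _ _ (by finiteness), lintegral_const_mul' _ _ (by finiteness),
      mul_assoc] at h1
    exact h1
  have outer := lintegral_mono (μ := μ.restrict (annulus E r)) inner
  rw [lintegral_mul_const' _ _ (by finiteness), lintegral_add_left measurable_const,
    lintegral_const, Measure.restrict_apply_univ, lintegral_const_mul' _ _ (by finiteness)] at outer
  have h3 : F * W * M ≤ (F' * Q + T * (M⁻¹ * D)) * M := by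
    calc F * W * M = F * (W * M) := mul_assoc _ _ _
      _ ≤ K * Q * F' * m + T * D := outer
      _ = F' * Q * M + T * (M⁻¹ * M * D) := by
        rw [ENNReal.inv_mul_cancel hM0 hMt, one_mul, hmM]; ring
      _ = _ := by ring
  exact (ENNReal.mul_le_mul_iff_left hM0 hMt).1 h3

end IsOrliczPair

/-- Discrete Hardy-type summation: a one-step recursion with critical weights sums up. -/
lemma sum_mul_rpow_neg_le {p : ℝ} (hp : 1 < p) {F D : ℕ → ENNReal} {T : ENNReal} (h0 : F 0 = 0)
    (hF : ∀ n : ℕ, F (n + 1) * ENNReal.ofReal (((n : ℝ) + 1 / 2 + 1 / 2) ^ (1 - p)) ≤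
      F n * ENNReal.ofReal (((n : ℝ) + 1 / 2) ^ (1 - p)) + T * D n) (M : ℕ) :
    ∑ n ∈ Finset.range M, F (n + 1) * ENNReal.ofReal ((p - 1) / (p + 2) * ((n : ℝ) + 1) ^ (-p)) +
      F M * ENNReal.ofReal (((M : ℝ) + 1 / 2) ^ (1 - p)) ≤ T * ∑ n ∈ Finset.range M, D n := by
  induction M with
  | zero => simp [h0]
  | succ M ih =>
    rw [Finset.sum_range_succ, Finset.sum_range_succ, mul_add]
    have hM : (0 : ℝ) < (M : ℝ) + 1 := by positivity
    have hle : ENNReal.ofReal ((p - 1) / (p + 2) * ((M : ℝ) + 1) ^ (-p)) +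
        ENNReal.ofReal (((M + 1 : ℕ) + 1 / 2 : ℝ) ^ (1 - p)) ≤
        ENNReal.ofReal (((M : ℝ) + 1 / 2 + 1 / 2) ^ (1 - p)) := by
      have hp' : 0 < (p - 1) / (p + 2) := div_pos (by linarith) (by linarith)
      rw [← ENNReal.ofReal_add (by positivity) (by positivity)]
      refine ENNReal.ofReal_le_ofReal ?_
      have := rpow_add_half_add_le hp (n := (M : ℝ) + 1) (by linarith [M.cast_nonneg (α := ℝ)])
      push_cast
      rw [show (M : ℝ) + 1 / 2 + 1 / 2 = M + 1 by ring]
      linarith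
    calc _ = ∑ n ∈ Finset.range M,
          F (n + 1) * ENNReal.ofReal ((p - 1) / (p + 2) * ((n : ℝ) + 1) ^ (-p)) +
          F (M + 1) * (ENNReal.ofReal ((p - 1) / (p + 2) * ((M : ℝ) + 1) ^ (-p)) +
            ENNReal.ofReal (((M + 1 : ℕ) + 1 / 2 : ℝ) ^ (1 - p))) := by ring
      _ ≤ ∑ n ∈ Finset.range M,
          F (n + 1) * ENNReal.ofReal ((p - 1) / (p + 2) * ((n : ℝ) + 1) ^ (-p)) +
          (F M * ENNReal.ofReal (((M : ℝ) + 1 / 2) ^ (1 - p)) + T * D M) := by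
        gcongr
        exact (mul_le_mul_right hle _).trans (hF M)
      _ ≤ _ := by
        rw [← add_assoc]
        gcongr

lemma tsum_mul_rpow_neg_le {p : ℝ} (hp : 1 < p) {F D : ℕ → ENNReal} {T : ENNReal} (h0 : F 0 = 0)
    (hF : ∀ n : ℕ, F (n + 1) * ENNReal.ofReal (((n : ℝ) + 1 / 2 + 1 / 2) ^ (1 - p)) ≤
      F n * ENNReal.ofReal (((n : ℝ) + 1 / 2) ^ (1 - p)) + T * D n) :
    ∑' n, F (n + 1) * ENNReal.ofReal ((p - 1) / (p + 2) * ((n : ℝ) + 1) ^ (-p)) ≤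
      T * ∑' n, D n := by
  rw [ENNReal.tsum_eq_iSup_nat]
  refine iSup_le fun M => le_self_add.trans ((sum_mul_rpow_neg_le hp h0 hF M).trans ?_)
  gcongr
  exact ENNReal.sum_le_tsum _

lemma rpow_le_rpow_abs_mul_rpow {r z c : ℝ} (a : ℝ) (hr : 0 < r) (hc : 1 ≤ c) (hrz : r ≤ z)
    (hz : z ≤ c * r) : r ^ a ≤ c ^ |a| * z ^ a := by
  have hc0 : 0 < c := by linarith
  have hz0 : 0 < z := by linarith
  rcases le_or_gt 0 a with ha | ha
  · calc r ^ a ≤ z ^ a := Real.rpow_le_rpow hr.le hrz ha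
      _ ≤ c ^ |a| * z ^ a := le_mul_of_one_le_left (Real.rpow_nonneg hz0.le _)
          (Real.one_le_rpow hc (abs_nonneg a))
  · calc r ^ a = c ^ |a| * (c * r) ^ a := by
          rw [abs_of_neg ha, Real.mul_rpow hc0.le hr.le, ← mul_assoc, ← Real.rpow_add hc0,
            neg_add_cancel, Real.rpow_zero, one_mul]
      _ ≤ c ^ |a| * z ^ a := by
          exact mul_le_mul_of_nonneg_left (Real.rpow_le_rpow_of_nonpos hz0 hz ha.le)
            (Real.rpow_nonneg hc0.le _)

namespace IsOrliczPair

variable {Φ φ : ℝ → ℝ} {E : Type*} [NormedAddCommGroup E]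

/-- Pointwise lower bound of the Gagliardo-type kernel on a product of consecutive annuli. -/
lemma map_div_rpow_le_kernel (h : IsOrliczPair Φ φ) {p : ℝ}
    (hp : p ∈ upperBounds (orliczRatioSet Φ φ)) {s α₁ α₂ : ℝ} (hs : 0 ≤ s) {r : ℝ} (hr : 0 < r)
    {x y : E} (hx : x ∈ annulus E r) (hy : y ∈ annulus E (2 * r)) (d : ℕ) {v : ℝ} (hv : 0 ≤ v) :
    Φ (v / r ^ (s - α₁ - α₂)) / (2 * r) ^ d ≤ (2 ^ |α₁| * 4 ^ |α₂| * 6 ^ s) ^ p * 3 ^ d *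
      (Φ (‖x‖ ^ α₁ * ‖y‖ ^ α₂ * (v / ‖x - y‖ ^ s)) / ‖x - y‖ ^ (d : ℝ)) := by
  have hxy : 0 < ‖x - y‖ := by
    have h1 := norm_sub_norm_le y x
    rw [norm_sub_rev] at h1
    linarith [hx.2, hy.1]
  have hxy6 : ‖x - y‖ ≤ 6 * r := (norm_sub_le x y).trans (by linarith [hx.2, hy.2])
  have hx0 : 0 < ‖x‖ := hr.trans hx.1
  have hy0 : 0 < ‖y‖ := by linarith [hy.1]
  set K : ℝ := 2 ^ |α₁| * 4 ^ |α₂| * 6 ^ s with hK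
  have hK1 : 1 ≤ K := one_le_mul_of_one_le_of_one_le (one_le_mul_of_one_le_of_one_le
    (Real.one_le_rpow (by norm_num) (abs_nonneg _)) (Real.one_le_rpow (by norm_num) (abs_nonneg _)))
    (Real.one_le_rpow (by norm_num) hs)
  have hsr : ‖x - y‖ ^ s ≤ 6 ^ s * r ^ s := by
    rw [← Real.mul_rpow (by norm_num) hr.le]
    exact Real.rpow_le_rpow hxy.le hxy6 hs
  have h1 := rpow_le_rpow_abs_mul_rpow α₁ hr one_le_two hx.1.le hx.2
  have h2 := rpow_le_rpow_abs_mul_rpow α₂ hr (by norm_num : (1 : ℝ) ≤ 4)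
    (by linarith [hy.1] : r ≤ ‖y‖) (by linarith [hy.2])
  have hrs : 0 < r ^ s := Real.rpow_pos_of_pos hr _
  have hxys : 0 < ‖x - y‖ ^ s := Real.rpow_pos_of_pos hxy _
  have harg : v / r ^ (s - α₁ - α₂) ≤ K * (‖x‖ ^ α₁ * ‖y‖ ^ α₂ * (v / ‖x - y‖ ^ s)) := by
    have e : v / r ^ (s - α₁ - α₂) = r ^ α₁ * r ^ α₂ * (v / r ^ s) := by
      have := Real.rpow_pos_of_pos hr α₁
      have := Real.rpow_pos_of_pos hr α₂
      rw [Real.rpow_sub hr, Real.rpow_sub hr]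
      field_simp
    have h3 : v / r ^ s ≤ 6 ^ s * (v / ‖x - y‖ ^ s) := by
      rw [← mul_div_assoc, div_le_div_iff₀ hrs hxys]
      calc v * ‖x - y‖ ^ s ≤ v * (6 ^ s * r ^ s) := by gcongr
        _ = 6 ^ s * v * r ^ s := by ring
    calc v / r ^ (s - α₁ - α₂) = r ^ α₁ * r ^ α₂ * (v / r ^ s) := e
      _ ≤ (2 ^ |α₁| * ‖x‖ ^ α₁) * (4 ^ |α₂| * ‖y‖ ^ α₂) * (6 ^ s * (v / ‖x - y‖ ^ s)) := by
        gcongr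
      _ = _ := by rw [hK]; ring
  set w := ‖x‖ ^ α₁ * ‖y‖ ^ α₂ * (v / ‖x - y‖ ^ s) with hw
  have hw0 : 0 ≤ w := by positivity
  have h4 : Φ (v / r ^ (s - α₁ - α₂)) ≤ K ^ p * Φ w :=
    (h.map_le_map (by positivity) harg).trans (h.map_mul_le hp hK1 hw0)
  have h5 : ‖x - y‖ ^ d ≤ 3 ^ d * (2 * r) ^ d := by
    rw [← mul_pow]
    exact pow_le_pow_left₀ hxy.le (by linarith) d
  have hKw : 0 ≤ K ^ p * Φ w := mul_nonneg (by positivity) (h.nonneg hw0)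
  rw [Real.rpow_natCast, ← mul_div_assoc, div_le_div_iff₀ (by positivity) (by positivity)]
  calc Φ (v / r ^ (s - α₁ - α₂)) * ‖x - y‖ ^ d ≤ K ^ p * Φ w * (3 ^ d * (2 * r) ^ d) := by gcongr
    _ = _ := by ring

variable [NormedSpace ℝ E] [MeasurableSpace E] [BorelSpace E] [FiniteDimensional ℝ E]

lemma exists_lintegral_annulus_le_kernel (h : IsOrliczPair Φ φ) [Nontrivial E]
    (μ : Measure E) [μ.IsAddHaarMeasure] {p : ℝ}
    (hp : p ∈ upperBounds (orliczRatioSet Φ φ)) {s : ℝ} (hs : 0 ≤ s) (α₁ α₂ : ℝ) :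
    ∃ C : ENNReal, C ≠ ⊤ ∧ ∀ (u : E → ℝ) (r : ℝ), 0 < r →
      (μ (annulus E (2 * r)))⁻¹ * ∫⁻ x in annulus E r, ∫⁻ y in annulus E (2 * r),
          ENNReal.ofReal (Φ (|u x - u y| / r ^ (s - α₁ - α₂))) ∂μ ∂μ ≤
        C * ∫⁻ x in annulus E r, ∫⁻ y, ENNReal.ofReal
          (Φ (‖x‖ ^ α₁ * ‖y‖ ^ α₂ * (|u x - u y| / ‖x - y‖ ^ s)) /
            ‖x - y‖ ^ (Module.finrank ℝ E : ℝ)) ∂μ ∂μ := by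
  set d := Module.finrank ℝ E
  set κ := μ (annulus E 1) with hκ
  have hκ0 : κ ≠ 0 := measure_annulus_pos μ one_pos
  have hκi : κ⁻¹ ≠ ⊤ := ENNReal.inv_ne_top.2 hκ0
  set B : ℝ := (2 ^ |α₁| * 4 ^ |α₂| * 6 ^ s) ^ p * 3 ^ d
  have hB : 0 ≤ B := by positivity
  refine ⟨κ⁻¹ * ENNReal.ofReal B, by finiteness, fun u r hr => ?_⟩
  have hm : (μ (annulus E (2 * r)))⁻¹ = κ⁻¹ * ENNReal.ofReal (((2 * r) ^ d)⁻¹) := by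
    have h2r : 0 < (2 * r) ^ d := by positivity
    rw [hκ, measure_annulus μ zero_le_one, measure_annulus μ (by positivity), one_pow,
      ENNReal.ofReal_one, one_mul, ENNReal.mul_inv (Or.inl (by simpa using h2r))
      (Or.inl ENNReal.ofReal_ne_top), ENNReal.ofReal_inv_of_pos h2r, mul_comm]
  rw [hm, mul_assoc, mul_assoc]
  refine mul_le_mul_right ?_ κ⁻¹
  rw [← lintegral_const_mul' _ _ (by finiteness), ← lintegral_const_mul' _ _ (by finiteness)]
  refine setLIntegral_mono' (measurableSet_annulus r) fun x hx => ?_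
  rw [← lintegral_const_mul' _ _ (by finiteness), ← lintegral_const_mul' _ _ (by finiteness)]
  refine (setLIntegral_mono' (measurableSet_annulus (2 * r)) fun y hy => ?_).trans
    (setLIntegral_le_lintegral _ _)
  rw [← ENNReal.ofReal_mul (by positivity), ← ENNReal.ofReal_mul hB]
  refine ENNReal.ofReal_le_ofReal ?_
  rw [← div_eq_inv_mul]
  exact h.map_div_rpow_le_kernel hp hs hr hx hy d (abs_nonneg _)

/-- The critical logarithmic Hardy integral over a ball is controlled by its annular pieces. -/
lemma setLIntegral_ball_le_tsum (h : IsOrliczPair Φ φ) [Nontrivial E] (μ : Measure E)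
    [μ.IsAddHaarMeasure] {p γ R : ℝ} (hp : 0 ≤ p) (hγ : 0 ≤ γ) (hR : 0 < R) (u : E → ℝ) :
    ∫⁻ x in Metric.ball (0 : E) R,
        ENNReal.ofReal (Φ (|u x| / ‖x‖ ^ γ) / Real.log (2 * R / ‖x‖) ^ p) ∂μ ≤
      ENNReal.ofReal (Real.log 2 ^ (-p)) * ∑' n : ℕ,
        (∫⁻ x in annulus E (R * (1 / 2) ^ (n + 1)),
          ENNReal.ofReal (Φ (|u x| / (R * (1 / 2) ^ (n + 1)) ^ γ)) ∂μ) *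
        ENNReal.ofReal (((n : ℝ) + 1) ^ (-p)) := by
  set f : E → ENNReal := fun x =>
    ENNReal.ofReal (Φ (|u x| / ‖x‖ ^ γ) / Real.log (2 * R / ‖x‖) ^ p)
  have hsub : Metric.ball (0 : E) R ⊆ {0} ∪ ⋃ n : ℕ, annulus E (R * (1 / 2) ^ (n + 1)) :=
    sdiff_subset_iff.1 (ball_diff_zero_subset_iUnion_annulus hR)
  have hlog2 : 0 < Real.log 2 := Real.log_pos one_lt_two
  calc ∫⁻ x in Metric.ball (0 : E) R, f x ∂μ
      ≤ ∫⁻ x in {0} ∪ ⋃ n : ℕ, annulus E (R * (1 / 2) ^ (n + 1)), f x ∂μ :=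
        lintegral_mono_set hsub
    _ ≤ ∫⁻ x in {0}, f x ∂μ + ∫⁻ x in ⋃ n : ℕ, annulus E (R * (1 / 2) ^ (n + 1)), f x ∂μ :=
        lintegral_union_le _ _ _
    _ ≤ ∑' n : ℕ, ∫⁻ x in annulus E (R * (1 / 2) ^ (n + 1)), f x ∂μ := by
        rw [setLIntegral_measure_zero _ _ (measure_singleton (0 : E)), zero_add]
        exact lintegral_iUnion_le _ _
    _ ≤ _ := by
        rw [← ENNReal.tsum_mul_left]
        refine ENNReal.tsum_le_tsum fun n => ?_
        rw [mul_left_comm, ← ENNReal.ofReal_mul (by positivity),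
          ← lintegral_mul_const' _ _ (by finiteness)]
        refine setLIntegral_mono' (measurableSet_annulus _) fun x hx => ?_
        set r := R * (1 / 2) ^ (n + 1) with hr
        have hr0 : 0 < r := by positivity
        have hx0 : 0 < ‖x‖ := hr0.trans hx.1
        have hn : (0 : ℝ) < n + 1 := by positivity
        rw [← Real.mul_rpow hlog2.le hn.le, ← ENNReal.ofReal_mul (h.nonneg (by positivity)),
          Real.rpow_neg (by positivity), ← div_eq_mul_inv]
        refine ENNReal.ofReal_le_ofReal ?_
        have hlog : Real.log 2 * (n + 1) ≤ Real.log (2 * R / ‖x‖) := by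
          have e : Real.log 2 * (n + 1) = Real.log (2 ^ (n + 1)) := by
            rw [Real.log_pow]; push_cast; ring
          rw [e]
          refine Real.log_le_log (by positivity) ?_
          rw [le_div_iff₀ hx0]
          calc (2 : ℝ) ^ (n + 1) * ‖x‖ ≤ 2 ^ (n + 1) * (2 * r) := by gcongr; exact hx.2
            _ = 2 * R := by
              rw [hr, one_div, inv_pow]; field_simp
        have h1 : Φ (|u x| / ‖x‖ ^ γ) ≤ Φ (|u x| / r ^ γ) := by
          refine h.map_le_map (by positivity) ?_
          have := hx.1.le
          gcongr
        have h2 := h.nonneg (by positivity : 0 ≤ |u x| / r ^ γ)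
        gcongr

end IsOrliczPair

/-- Critical-case weighted fractional Orlicz–Hardy inequality with logarithmic
correction on a ball, in the case `γ = N/p⁺_Φ`. -/
theorem critical_orlicz_hardy_log_ball
    (N : ℕ) (hN : 1 ≤ N) (s α₁ α₂ R : ℝ) (hs : s ∈ Ioo (0:ℝ) 1) (hR : 0 < R)
    (Φ φ : ℝ → ℝ) (h : IsOrliczPair Φ φ)
    (pp : ℝ) (hpp : IsLUB (orliczRatioSet Φ φ) pp)
    (γ : ℝ) (hγ : γ = s - α₁ - α₂) (hcrit : γ = (N : ℝ) / pp) :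
    ∃ C > 0, ∀ u : EuclideanSpace ℝ (Fin N) → ℝ,
      ContDiff ℝ 1 u → HasCompactSupport u →
      tsupport u ⊆ Metric.ball (0 : EuclideanSpace ℝ (Fin N)) R →
      (∫⁻ x in Metric.ball (0 : EuclideanSpace ℝ (Fin N)) R,
          ENNReal.ofReal
            (Φ (|u x| / ‖x‖ ^ γ) / Real.log (2 * R / ‖x‖) ^ pp)) ≤
        ENNReal.ofReal C *
          ∫⁻ x, ∫⁻ y, ENNReal.ofReal
            (Φ (‖x‖ ^ α₁ * ‖y‖ ^ α₂ * (|u x - u y| / ‖x - y‖ ^ s)) /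
              ‖x - y‖ ^ (N:ℝ)) := by
  have hp := hpp.1
  have hp1 : 1 < pp := h.one_lt_of_mem_upperBounds hp
  have hd : Module.finrank ℝ (EuclideanSpace ℝ (Fin N)) = N := finrank_euclideanSpace_fin
  have : Nontrivial (EuclideanSpace ℝ (Fin N)) :=
    Module.nontrivial_of_finrank_pos (R := ℝ) (by omega)
  have hγ0 : 0 ≤ γ := by rw [hcrit]; positivity
  have hγp : γ * pp = Module.finrank ℝ (EuclideanSpace ℝ (Fin N)) := by
    rw [hcrit, hd]; field_simp
  obtain ⟨C, hC, hker⟩ := h.exists_lintegral_annulus_le_kernel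
    (volume : Measure (EuclideanSpace ℝ (Fin N))) hp hs.1.le α₁ α₂
  rw [hd, ← hγ] at hker
  set c : ℝ := (pp - 1) / (pp + 2)
  have hc : 0 < c := div_pos (by linarith) (by linarith)
  set T := ENNReal.ofReal ((1 / 2 : ℝ) ^ (1 - pp))
  set L := ENNReal.ofReal (Real.log 2 ^ (-pp))
  set A := L * (ENNReal.ofReal c⁻¹ * (T * C))
  have hA : A ≠ ⊤ := by finiteness
  refine ⟨A.toReal + 1, by positivity, fun u hu _ hsupp => ?_⟩
  set r : ℕ → ℝ := fun n => R * (1 / 2) ^ n with hr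
  have hr0 : ∀ n, 0 < r n := fun n => by positivity
  have hr2 : ∀ n, 2 * r (n + 1) = r n := fun n => by simp only [hr]; ring
  set F : ℕ → ENNReal := fun n =>
    ∫⁻ x in annulus (EuclideanSpace ℝ (Fin N)) (r n), ENNReal.ofReal (Φ (|u x| / r n ^ γ))
  set G : EuclideanSpace ℝ (Fin N) → ENNReal := fun x => ∫⁻ y, ENNReal.ofReal
    (Φ (‖x‖ ^ α₁ * ‖y‖ ^ α₂ * (|u x - u y| / ‖x - y‖ ^ s)) / ‖x - y‖ ^ (N : ℝ))
  have hF0 : F 0 = 0 := by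
    refine (setLIntegral_congr_fun (measurableSet_annulus _) fun x hx => ?_).trans lintegral_zero
    have hux : u x = 0 := by
      refine image_eq_zero_of_notMem_tsupport fun hx' => ?_
      have h1 := mem_ball_zero_iff.1 (hsupp hx')
      have h2 := hx.1
      simp only [hr, pow_zero, mul_one] at h2
      linarith
    simp [hux, h.map_zero]
  have hrec : ∀ n : ℕ, F (n + 1) * ENNReal.ofReal (((n : ℝ) + 1 / 2 + 1 / 2) ^ (1 - pp)) ≤
      F n * ENNReal.ofReal (((n : ℝ) + 1 / 2) ^ (1 - pp)) + T *
        (C * ∫⁻ x in annulus (EuclideanSpace ℝ (Fin N)) (r (n + 1)), G x) := by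
    intro n
    have h1 := h.setLIntegral_annulus_le volume hp hγ0 hγp hu.continuous (hr0 (n + 1))
      (by positivity : (0 : ℝ) < n + 1 / 2) (one_half_pos (α := ℝ))
    have h2 := hker u (r (n + 1)) (hr0 _)
    rw [hr2] at h1 h2
    exact h1.trans (by gcongr)
  have hsum := tsum_mul_rpow_neg_le hp1 hF0 hrec
  have hGsum : ∑' n, (C * ∫⁻ x in annulus (EuclideanSpace ℝ (Fin N)) (r (n + 1)), G x) ≤
      C * ∫⁻ x, G x := by
    rw [ENNReal.tsum_mul_left, ← lintegral_iUnion (fun n => measurableSet_annulus _)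
      (pairwise_disjoint_annulus hR)]
    exact mul_le_mul_right (setLIntegral_le_lintegral _ _) C
  have hcc : ENNReal.ofReal c⁻¹ * ENNReal.ofReal c = 1 := by
    rw [← ENNReal.ofReal_mul (by positivity), inv_mul_cancel₀ hc.ne', ENNReal.ofReal_one]
  calc _ ≤ L * ∑' n : ℕ, F (n + 1) * ENNReal.ofReal (((n : ℝ) + 1) ^ (-pp)) :=
        h.setLIntegral_ball_le_tsum volume (by linarith) hγ0 hR u
    _ = L * (ENNReal.ofReal c⁻¹ *
          ∑' n : ℕ, F (n + 1) * ENNReal.ofReal (c * ((n : ℝ) + 1) ^ (-pp))) := by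
        congr 1
        rw [← ENNReal.tsum_mul_left]
        refine tsum_congr fun n => ?_
        rw [ENNReal.ofReal_mul hc.le, mul_left_comm (F _), ← mul_assoc, hcc, one_mul]
    _ ≤ L * (ENNReal.ofReal c⁻¹ * (T * (C * ∫⁻ x, G x))) := by
        gcongr
        exact hsum.trans (by gcongr)
    _ = A * ∫⁻ x, G x := by ring
    _ ≤ ENNReal.ofReal (A.toReal + 1) * ∫⁻ x, G x := by
        gcongr
        rw [ENNReal.le_ofReal_iff_toReal_le hA (by positivity)]
        linarith
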